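/- Let N ≥ 2 and let B ⊂ ℝ^N be the open unit ball. There exists a continuous ρ : B → (0,∞) such that, for every γ > 0, sup { ∫_B Φ^γ(u(x)) ρ(x)^{N/2} dx : u ∈ C_c^∞(B), ∫_B |∇u(x)|^N dx ≤ 1 } < +∞ if and only if 0 < γ < α_N. In particular, at the critical exponent γ = α_N the supremum is infinite although it is finite for every subcritical exponent. -/

import Mathlib

open MeasureTheory Real

/-- `ω_{N-1}`, the `(N-1)`-dimensional measure of the unit sphere in `ℝ^N`. -/
noncomputable def sphereVol (N : ℕ) : ℝ :=
  N * Real.pi ^ ((N : ℝ) / 2) / Real.Gamma ((N : ℝ) / 2 + 1)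

/-- `α_N := N ω_{N-1}^{1/(N-1)}`. -/
noncomputable def alphaMT (N : ℕ) : ℝ := N * sphereVol N ^ ((1 : ℝ) / ((N : ℝ) - 1))

/-- `Φ^γ(t) := e^{γ |t|^{N/(N-1)}} - ∑_{j=0}^{N-2} γ^j |t|^{jN/(N-1)} / j!`. -/
noncomputable def PhiGamma (N : ℕ) (γ : ℝ) (t : ℝ) : ℝ :=
  Real.exp (γ * |t| ^ ((N : ℝ) / ((N : ℝ) - 1))) -
    ∑ j ∈ Finset.range (N - 1),
      γ ^ j * |t| ^ ((j : ℝ) * N / ((N : ℝ) - 1)) / (Nat.factorial j : ℝ)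

/-- The open unit ball of `ℝ^N`. -/
noncomputable def unitBall (N : ℕ) : Set (EuclideanSpace ℝ (Fin N)) := Metric.ball 0 1

/-- `u ∈ C_c^∞(Ω)`: smooth, compactly supported, with support contained in `Ω`. -/
def IsTest {N : ℕ} (Ω : Set (EuclideanSpace ℝ (Fin N)))
    (u : EuclideanSpace ℝ (Fin N) → ℝ) : Prop :=
  ContDiff ℝ (⊤ : ℕ∞) u ∧ HasCompactSupport u ∧ tsupport u ⊆ Ω

lemma sphereVol_eq (N : ℕ) (hN : 2 ≤ N) :
    sphereVol N = N * (volume : Measure (EuclideanSpace ℝ (Fin N))).real (Metric.ball 0 1) := by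
  have : Nonempty (Fin N) := ⟨⟨0, by omega⟩⟩
  have hG : 0 < Real.Gamma ((N : ℝ) / 2 + 1) := Real.Gamma_pos_of_pos (by positivity)
  rw [Measure.real, EuclideanSpace.volume_ball, sphereVol]
  simp only [ENNReal.ofReal_one, one_pow, one_mul, Fintype.card_fin]
  rw [ENNReal.toReal_ofReal (by positivity), Real.sqrt_eq_rpow, ← Real.rpow_natCast,
    ← Real.rpow_mul Real.pi_pos.le, mul_div_assoc]
  congr 3
  ring

lemma sphereVol_pos (N : ℕ) (hN : 2 ≤ N) : 0 < sphereVol N := by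
  have hG : 0 < Real.Gamma ((N : ℝ) / 2 + 1) := Real.Gamma_pos_of_pos (by positivity)
  have : (0 : ℝ) < N := by exact_mod_cast (by omega : 0 < N)
  unfold sphereVol
  positivity

lemma toSphere_univ_eq (N : ℕ) (hN : 2 ≤ N) :
    (volume : Measure (EuclideanSpace ℝ (Fin N))).toSphere Set.univ
      = ENNReal.ofReal (sphereVol N) := by
  rw [sphereVol_eq N hN, Measure.toSphere_apply_univ, ENNReal.ofReal_mul (by positivity),
    measureReal_def, ENNReal.ofReal_toReal measure_ball_lt_top.ne]
  simp

lemma lintegral_polar (N : ℕ) (hN : 2 ≤ N) (f : EuclideanSpace ℝ (Fin N) → ENNReal)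
    (hf : Measurable f) :
    ∫⁻ z, f z = ∫⁻ θ : Metric.sphere (0 : EuclideanSpace ℝ (Fin N)) 1,
      ∫⁻ r in Set.Ioi (0 : ℝ), ENNReal.ofReal (r ^ (N - 1)) *
        f (r • (θ : EuclideanSpace ℝ (Fin N))) ∂volume
      ∂(volume : Measure (EuclideanSpace ℝ (Fin N))).toSphere := by
  have : Nonempty (Fin N) := ⟨⟨0, by omega⟩⟩
  have mp := (volume : Measure (EuclideanSpace ℝ (Fin N))).measurePreserving_homeomorphUnitSphereProd
  have h1 : ∫⁻ z, f z = ∫⁻ x : ({(0)}ᶜ : Set (EuclideanSpace ℝ (Fin N))), f x ∂(volume.comap Subtype.val) := by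
    rw [lintegral_subtype_comap (measurableSet_singleton _).compl f, restrict_compl_singleton]
  have h2 : ∀ x : ({(0)}ᶜ : Set (EuclideanSpace ℝ (Fin N))), f x =
      (fun p : Metric.sphere (0 : EuclideanSpace ℝ (Fin N)) 1 × Set.Ioi (0:ℝ) =>
        f ((p.2 : ℝ) • (p.1 : EuclideanSpace ℝ (Fin N)))) (homeomorphUnitSphereProd _ x) := by
    intro x
    have hx : ‖(x : EuclideanSpace ℝ (Fin N))‖ ≠ 0 := norm_ne_zero_iff.2 x.2
    simp [homeomorphUnitSphereProd, smul_smul, hx]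
  have hm : Measurable (fun p : Metric.sphere (0 : EuclideanSpace ℝ (Fin N)) 1 × Set.Ioi (0:ℝ) =>
        f ((p.2 : ℝ) • (p.1 : EuclideanSpace ℝ (Fin N)))) := by
    apply hf.comp
    exact (measurable_subtype_coe.comp measurable_snd).smul (measurable_subtype_coe.comp measurable_fst)
  rw [h1, lintegral_congr h2, mp.lintegral_comp hm, lintegral_prod _ hm.aemeasurable]
  refine lintegral_congr fun θ => ?_
  rw [Measure.volumeIoiPow, lintegral_withDensity_eq_lintegral_mul]
  · simp only [finrank_euclideanSpace, Fintype.card_fin, Pi.mul_apply]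
    rw [lintegral_subtype_comap measurableSet_Ioi (fun a : ℝ => ENNReal.ofReal (a ^ (N - 1)) *
        f (a • (θ : EuclideanSpace ℝ (Fin N))))]
  · fun_prop
  · exact hm.comp (by fun_prop)

lemma lintegral_radial (N : ℕ) (hN : 2 ≤ N) (f : ℝ → ENNReal) (hf : Measurable f) :
    ∫⁻ z : EuclideanSpace ℝ (Fin N), f ‖z‖ = ENNReal.ofReal (sphereVol N) *
      ∫⁻ r in Set.Ioi (0 : ℝ), ENNReal.ofReal (r ^ (N - 1)) * f r := by
  rw [lintegral_polar N hN (fun z => f ‖z‖) (hf.comp measurable_norm)]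
  have : ∀ θ : Metric.sphere (0 : EuclideanSpace ℝ (Fin N)) 1,
      ∫⁻ r in Set.Ioi (0 : ℝ), ENNReal.ofReal (r ^ (N - 1)) *
        f ‖r • (θ : EuclideanSpace ℝ (Fin N))‖ =
      ∫⁻ r in Set.Ioi (0 : ℝ), ENNReal.ofReal (r ^ (N - 1)) * f r := by
    intro θ
    refine setLIntegral_congr_fun measurableSet_Ioi fun r hr => ?_
    have : (0:ℝ) < r := hr
    simp [norm_smul, abs_of_pos this]
  simp_rw [this]
  rw [lintegral_const, toSphere_univ_eq N hN, mul_comm]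

/-- Integral over an annulus of a power of the norm, exponent `a - N`. -/
lemma lintegral_radial_pow (N : ℕ) (hN : 2 ≤ N) (a : ℝ) (s : Set ℝ) (hs : MeasurableSet s)
    (hs0 : s ⊆ Set.Ioi 0) :
    ∫⁻ z : EuclideanSpace ℝ (Fin N) in (fun z => ‖z‖) ⁻¹' s, ENNReal.ofReal (‖z‖ ^ (a - N)) =
      ENNReal.ofReal (sphereVol N) * ∫⁻ r in s, ENNReal.ofReal (r ^ (a - 1)) := by
  rw [← lintegral_indicator (measurable_norm hs)]
  have := lintegral_radial N hN (s.indicator fun r => ENNReal.ofReal (r ^ (a - N)))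
    ((by fun_prop : Measurable fun r : ℝ => ENNReal.ofReal (r ^ (a - N))).indicator hs)
  have e : ∀ z : EuclideanSpace ℝ (Fin N), ((fun z => ‖z‖) ⁻¹' s).indicator
      (fun z => ENNReal.ofReal (‖z‖ ^ (a - N))) z =
      s.indicator (fun r => ENNReal.ofReal (r ^ (a - N))) ‖z‖ := fun z => rfl
  rw [lintegral_congr e, this]
  congr 1
  rw [← lintegral_indicator hs, ← lintegral_indicator measurableSet_Ioi]
  refine lintegral_congr fun r => ?_
  by_cases hr : r ∈ s
  · have h0 : 0 < r := hs0 hr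
    rw [Set.indicator_of_mem hr, Set.indicator_of_mem (hs0 hr), Set.indicator_of_mem hr,
      ← ENNReal.ofReal_mul (by positivity), ← Real.rpow_natCast, ← Real.rpow_add h0]
    congr 2
    rw [Nat.cast_sub (by omega)]
    push_cast
    ring
  · rw [Set.indicator_of_notMem hr]
    by_cases h : r ∈ Set.Ioi (0:ℝ)
    · rw [Set.indicator_of_mem h, Set.indicator_of_notMem hr, mul_zero]
    · rw [Set.indicator_of_notMem h]

lemma representation (N : ℕ) (hN : 2 ≤ N) (u : EuclideanSpace ℝ (Fin N) → ℝ)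
    (hu : ContDiff ℝ (⊤ : ℕ∞) u) (hc : HasCompactSupport u) (x : EuclideanSpace ℝ (Fin N)) :
    ENNReal.ofReal (sphereVol N * |u x|) ≤
      ∫⁻ z, ‖fderiv ℝ u (x + z)‖ₑ * ENNReal.ofReal (‖z‖ ^ (1 - (N:ℝ))) := by
  have hfc : Continuous (fderiv ℝ u) := hu.continuous_fderiv (by simp)
  have hmeas : Measurable fun z => ‖fderiv ℝ u (x + z)‖ₑ * ENNReal.ofReal (‖z‖ ^ (1 - (N:ℝ))) := by
    apply Measurable.fun_mul
    · exact (Continuous.enorm (hfc.comp (by fun_prop))).measurable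
    · fun_prop
  rw [lintegral_polar N hN _ hmeas]
  have key : ∀ θ : Metric.sphere (0 : EuclideanSpace ℝ (Fin N)) 1,
      ENNReal.ofReal |u x| ≤ ∫⁻ r in Set.Ioi (0 : ℝ), ENNReal.ofReal (r ^ (N - 1)) *
        (‖fderiv ℝ u (x + r • (θ : EuclideanSpace ℝ (Fin N)))‖ₑ *
          ENNReal.ofReal (‖r • (θ : EuclideanSpace ℝ (Fin N))‖ ^ (1 - (N:ℝ)))) := by
    intro θ
    have e1 : ∀ r ∈ Set.Ioi (0 : ℝ), ENNReal.ofReal (r ^ (N - 1)) *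
        (‖fderiv ℝ u (x + r • (θ : EuclideanSpace ℝ (Fin N)))‖ₑ *
          ENNReal.ofReal (‖r • (θ : EuclideanSpace ℝ (Fin N))‖ ^ (1 - (N:ℝ)))) =
        ‖fderiv ℝ u (x + r • (θ : EuclideanSpace ℝ (Fin N)))‖ₑ := by
      intro r hr
      have h0 : (0:ℝ) < r := hr
      rw [mul_left_comm, ← ENNReal.ofReal_mul (by positivity)]
      have : r ^ (N - 1) * ‖r • (θ : EuclideanSpace ℝ (Fin N))‖ ^ (1 - (N:ℝ)) = 1 := by
        have : ‖r • (θ : EuclideanSpace ℝ (Fin N))‖ = r := by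
          simp [norm_smul, abs_of_pos h0]
        rw [this, ← Real.rpow_natCast, ← Real.rpow_add h0, Nat.cast_sub (by omega)]
        simp
      rw [this]; simp
    rw [setLIntegral_congr_fun measurableSet_Ioi e1]
    set v : ℝ → ℝ := fun r => u (x + r • (θ : EuclideanSpace ℝ (Fin N))) with hv
    have hvd : ∀ r, HasDerivAt v (fderiv ℝ u (x + r • (θ : EuclideanSpace ℝ (Fin N))) θ) r := by
      intro r
      have h1 : HasDerivAt (fun r : ℝ => x + r • (θ : EuclideanSpace ℝ (Fin N))) θ r := by
        simpa using ((hasDerivAt_id r).smul_const (θ : EuclideanSpace ℝ (Fin N))).const_add x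
      exact ((hu.differentiable (by simp) _).hasFDerivAt).comp_hasDerivAt r h1
    obtain ⟨R, hR⟩ := hc.isCompact.isBounded.subset_ball 0
    set T : ℝ := max (R + ‖x‖) 0 with hT
    have hvT : v T = 0 := by
      apply image_eq_zero_of_notMem_tsupport (f := u)
      intro hmem
      have := hR hmem
      rw [mem_ball_zero_iff] at this
      have h2 : ‖T • (θ : EuclideanSpace ℝ (Fin N))‖ = T := by
        simp only [norm_smul, norm_eq_of_mem_sphere, mul_one, Real.norm_eq_abs]
        exact abs_of_nonneg (le_max_right _ _)
      have h3 : ‖T • (θ : EuclideanSpace ℝ (Fin N))‖ ≤ ‖x + T • (θ : EuclideanSpace ℝ (Fin N))‖ + ‖x‖ := by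
        have := norm_sub_le (x + T • (θ : EuclideanSpace ℝ (Fin N))) x
        simpa using this
      have h4 : R + ‖x‖ ≤ T := le_max_left _ _
      linarith
    have hcont : Continuous fun r : ℝ => fderiv ℝ u (x + r • (θ : EuclideanSpace ℝ (Fin N))) θ := by
      have : Continuous fun r : ℝ => fderiv ℝ u (x + r • (θ : EuclideanSpace ℝ (Fin N))) :=
        hfc.comp (by fun_prop)
      exact this.clm_apply continuous_const
    have hI := intervalIntegral.integral_eq_sub_of_hasDerivAt (a := 0) (b := T) (fun r _ => hvd r)
      (hcont.intervalIntegrable _ _)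
    rw [hvT, zero_sub] at hI
    have hv0 : v 0 = u x := by simp [hv]
    have : |u x| = ‖∫ r in (0:ℝ)..T, fderiv ℝ u (x + r • (θ : EuclideanSpace ℝ (Fin N))) θ‖ := by
      rw [hI, hv0]; simp
    rw [this, ofReal_norm, intervalIntegral.integral_of_le (le_max_right _ _)]
    refine (enorm_integral_le_lintegral_enorm _).trans ?_
    refine (lintegral_mono' (Measure.restrict_mono (Set.Ioc_subset_Ioi_self) le_rfl) ?_)
    intro r
    have := (fderiv ℝ u (x + r • (θ : EuclideanSpace ℝ (Fin N)))).le_opENorm θ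
    refine this.trans ?_
    have : ‖(θ : EuclideanSpace ℝ (Fin N))‖ₑ = 1 := by
      rw [← ofReal_norm]; simp
    rw [this, mul_one]
  calc ENNReal.ofReal (sphereVol N * |u x|)
      = ∫⁻ θ : Metric.sphere (0 : EuclideanSpace ℝ (Fin N)) 1, ENNReal.ofReal |u x|
        ∂(volume : Measure (EuclideanSpace ℝ (Fin N))).toSphere := by
        rw [lintegral_const, toSphere_univ_eq N hN, mul_comm (ENNReal.ofReal _),
          ENNReal.ofReal_mul (sphereVol_pos N hN).le]
    _ ≤ _ := lintegral_mono key

lemma lintegral_inv_Ico (δ : ℝ) (hδ : 0 < δ) (hδ1 : δ ≤ 1) :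
    ∫⁻ r in Set.Ico δ 2, ENNReal.ofReal (r ^ ((0:ℝ) - 1)) = ENNReal.ofReal (Real.log (2 / δ)) := by
  have h1 : ∫ r in δ..2, r⁻¹ = Real.log (2 / δ) := integral_inv_of_pos hδ (by norm_num)
  have hint : IntervalIntegrable (fun r : ℝ => r⁻¹) volume δ 2 := by
    apply intervalIntegral.intervalIntegrable_inv
    · intro x hx
      rw [Set.uIcc_of_le (by linarith)] at hx
      exact (lt_of_lt_of_le hδ hx.1).ne'
    · exact continuousOn_id
  rw [Measure.restrict_congr_set Ico_ae_eq_Ioc, ← h1, intervalIntegral.integral_of_le (by linarith),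
    ofReal_integral_eq_lintegral_ofReal hint.1]
  · refine setLIntegral_congr_fun measurableSet_Ioc fun r hr => ?_
    rw [zero_sub, Real.rpow_neg_one]
  · filter_upwards [ae_restrict_mem measurableSet_Ioc] with r hr
    exact inv_nonneg.2 (hδ.le.trans hr.1.le)

lemma lintegral_pow_Ioo_lt_top (η : ℝ) (hη : 0 < η) :
    ∫⁻ r in Set.Ioo (0:ℝ) 2, ENNReal.ofReal (r ^ (η - 1)) < ⊤ := by
  have h := (intervalIntegral.intervalIntegrable_rpow' (a := 0) (b := 2)
    (by linarith : -1 < η - 1)).1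
  rw [Measure.restrict_congr_set Ioo_ae_eq_Ioc]
  exact h.lintegral_lt_top

/-- The finite measure `|z|^(η-N) dz` on the punctured ball of radius two. -/
noncomputable def kerMeas (N : ℕ) (η : ℝ) : Measure (EuclideanSpace ℝ (Fin N)) :=
  (volume.restrict ((fun z => ‖z‖) ⁻¹' Set.Ioo (0:ℝ) 2)).withDensity
    fun z => ENNReal.ofReal (‖z‖ ^ (η - N))

lemma kerMeas_univ_lt_top (N : ℕ) (hN : 2 ≤ N) (η : ℝ) (hη : 0 < η) :
    kerMeas N η Set.univ < ⊤ := by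
  rw [kerMeas, withDensity_apply _ MeasurableSet.univ, Measure.restrict_univ,
    lintegral_radial_pow N hN η _ measurableSet_Ioo Set.Ioo_subset_Ioi_self]
  exact ENNReal.mul_lt_top ENNReal.ofReal_lt_top (lintegral_pow_Ioo_lt_top η hη)

lemma holderConj (N : ℕ) (hN : 2 ≤ N) : (N : ℝ).HolderConjugate ((N : ℝ) / ((N : ℝ) - 1)) := by
  have : (2:ℝ) ≤ N := by exact_mod_cast hN
  exact Real.HolderConjugate.conjExponent (by linarith)

lemma young_bound (N : ℕ) (hN : 2 ≤ N) (η : ℝ) (hη : 0 < η)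
    (f : EuclideanSpace ℝ (Fin N) → ENNReal) (hf : Measurable f)
    (hf1 : ∫⁻ x, f x ^ (N:ℝ) ≤ 1) :
    ∫⁻ x, (∫⁻ z, f (x + z) ∂(kerMeas N η)) ^ (N:ℝ) ≤
      (kerMeas N η Set.univ) ^ ((1 / ((N : ℝ) / ((N : ℝ) - 1))) * N) * kerMeas N η Set.univ := by
  set ν := kerMeas N η with hν
  have : IsFiniteMeasure ν := ⟨kerMeas_univ_lt_top N hN η hη⟩
  have hN0 : (0:ℝ) < N := by exact_mod_cast (by omega : 0 < N)
  have hp := holderConj N hN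
  have hpt : ∀ x, (∫⁻ z, f (x + z) ∂ν) ^ (N:ℝ) ≤
      (∫⁻ z, f (x + z) ^ (N:ℝ) ∂ν) * (ν Set.univ) ^ ((1 / ((N : ℝ) / ((N : ℝ) - 1))) * N) := by
    intro x
    have h := ENNReal.lintegral_mul_le_Lp_mul_Lq ν hp (f := fun z => f (x + z)) (g := fun _ => 1)
      (hf.comp (measurable_const_add x)).aemeasurable aemeasurable_const
    simp only [Pi.mul_apply, mul_one, ENNReal.one_rpow, lintegral_const, one_mul] at h
    have h2 := ENNReal.rpow_le_rpow h hN0.le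
    rwa [ENNReal.mul_rpow_of_nonneg _ _ hN0.le, ← ENNReal.rpow_mul, ← ENNReal.rpow_mul,
      one_div_mul_cancel hN0.ne', ENNReal.rpow_one] at h2
  have hm : Measurable (Function.uncurry fun (x z : EuclideanSpace ℝ (Fin N)) =>
      f (x + z) ^ (N:ℝ)) :=
    (hf.comp measurable_add).pow_const _
  calc ∫⁻ x, (∫⁻ z, f (x + z) ∂ν) ^ (N:ℝ)
      ≤ ∫⁻ x, (∫⁻ z, f (x + z) ^ (N:ℝ) ∂ν) *
          (ν Set.univ) ^ ((1 / ((N : ℝ) / ((N : ℝ) - 1))) * N) := lintegral_mono hpt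
    _ = (∫⁻ x, ∫⁻ z, f (x + z) ^ (N:ℝ) ∂ν) *
          (ν Set.univ) ^ ((1 / ((N : ℝ) / ((N : ℝ) - 1))) * N) := by
        rw [lintegral_mul_const]
        exact hm.lintegral_prod_right
    _ = (∫⁻ z, ∫⁻ x, f (x + z) ^ (N:ℝ) ∂volume ∂ν) *
          (ν Set.univ) ^ ((1 / ((N : ℝ) / ((N : ℝ) - 1))) * N) := by
        rw [lintegral_lintegral_swap hm.aemeasurable]
    _ ≤ (∫⁻ z, 1 ∂ν) * (ν Set.univ) ^ ((1 / ((N : ℝ) / ((N : ℝ) - 1))) * N) := by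
        gcongr with z
        rw [lintegral_add_right_eq_self (fun x => f x ^ (N:ℝ)) z]
        exact hf1
    _ = _ := by rw [lintegral_one, mul_comm]

lemma far_bound (N : ℕ) (hN : 2 ≤ N) (δ : ℝ) (hδ : 0 < δ) (hδ1 : δ ≤ 1)
    (f : EuclideanSpace ℝ (Fin N) → ENNReal) (hf : Measurable f)
    (hf1 : ∫⁻ x, f x ^ (N:ℝ) ≤ 1) (x : EuclideanSpace ℝ (Fin N)) :
    ∫⁻ z in (fun z => ‖z‖) ⁻¹' Set.Ico δ 2, f (x + z) * ENNReal.ofReal (‖z‖ ^ (1 - (N:ℝ))) ≤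
      ENNReal.ofReal ((sphereVol N * Real.log (2 / δ)) ^ (1 / ((N : ℝ) / ((N : ℝ) - 1)))) := by
  have hN0 : (0:ℝ) < N := by exact_mod_cast (by omega : 0 < N)
  have hN2 : (2:ℝ) ≤ N := by exact_mod_cast hN
  have hp := holderConj N hN
  have hlog : 0 ≤ Real.log (2 / δ) := Real.log_nonneg (by rw [le_div_iff₀ hδ]; linarith)
  have h := ENNReal.lintegral_mul_le_Lp_mul_Lq
    (volume.restrict ((fun z : EuclideanSpace ℝ (Fin N) => ‖z‖) ⁻¹' Set.Ico δ 2)) hp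
    (f := fun z => f (x + z)) (g := fun z => ENNReal.ofReal (‖z‖ ^ (1 - (N:ℝ))))
      (hf.comp (measurable_const_add x)).aemeasurable (by fun_prop)
  refine h.trans ?_
  have h1 : (∫⁻ z in (fun z => ‖z‖) ⁻¹' Set.Ico δ 2, f (x + z) ^ (N:ℝ)) ^ (1 / (N:ℝ)) ≤ 1 := by
    apply ENNReal.rpow_le_one _ (by positivity)
    refine (setLIntegral_le_lintegral _ _).trans ?_
    rw [lintegral_add_left_eq_self (fun x => f x ^ (N:ℝ)) x]
    exact hf1
  have h2 : ∫⁻ z : EuclideanSpace ℝ (Fin N) in (fun z => ‖z‖) ⁻¹' Set.Ico δ 2,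
      ENNReal.ofReal (‖z‖ ^ (1 - (N:ℝ))) ^ ((N : ℝ) / ((N : ℝ) - 1)) =
      ENNReal.ofReal (sphereVol N * Real.log (2 / δ)) := by
    rw [ENNReal.ofReal_mul (sphereVol_pos N hN).le, ← lintegral_inv_Ico δ hδ hδ1,
      ← lintegral_radial_pow N hN 0 _ measurableSet_Ico (fun r hr => lt_of_lt_of_le hδ hr.1)]
    refine lintegral_congr fun z => ?_
    rw [ENNReal.ofReal_rpow_of_nonneg (by positivity) hp.symm.nonneg, ← Real.rpow_mul (by positivity)]
    congr 2
    have : (N:ℝ) - 1 ≠ 0 := by linarith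
    field_simp
    ring
  rw [h2, ENNReal.ofReal_rpow_of_nonneg (mul_nonneg (sphereVol_pos N hN).le hlog)
    (by have := hp.symm.nonneg; positivity)]
  exact (mul_le_mul_left h1 _).trans_eq (one_mul _)

lemma hedberg (N : ℕ) (hN : 2 ≤ N) (η : ℝ) (hη : 0 < η) (hη1 : η < 1)
    (δ : ℝ) (hδ : 0 < δ) (hδ1 : δ ≤ 1)
    (f : EuclideanSpace ℝ (Fin N) → ENNReal) (hf : Measurable f)
    (hf1 : ∫⁻ x, f x ^ (N:ℝ) ≤ 1) (hf0 : ∀ x, x ∉ unitBall N → f x = 0)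
    (x : EuclideanSpace ℝ (Fin N)) (hx : x ∈ unitBall N) :
    ∫⁻ z, f (x + z) * ENNReal.ofReal (‖z‖ ^ (1 - (N:ℝ))) ≤
      ENNReal.ofReal (δ ^ (1 - η)) * (∫⁻ z, f (x + z) ∂(kerMeas N η)) +
      ENNReal.ofReal ((sphereVol N * Real.log (2 / δ)) ^ (1 / ((N : ℝ) / ((N : ℝ) - 1)))) := by
  have : Nonempty (Fin N) := ⟨⟨0, by omega⟩⟩
  set F : EuclideanSpace ℝ (Fin N) → ENNReal :=
    fun z => f (x + z) * ENNReal.ofReal (‖z‖ ^ (1 - (N:ℝ))) with hF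
  have hFm : Measurable F := (hf.comp (measurable_const_add x)).mul (by fun_prop)
  set A := (fun z : EuclideanSpace ℝ (Fin N) => ‖z‖) ⁻¹' Set.Ioo 0 δ with hA
  set A2 := (fun z : EuclideanSpace ℝ (Fin N) => ‖z‖) ⁻¹' Set.Ico δ 2 with hA2
  have hAm : MeasurableSet A := measurable_norm measurableSet_Ioo
  have hA2m : MeasurableSet A2 := measurable_norm measurableSet_Ico
  have h0 : ∫⁻ z, F z = ∫⁻ z in {0}ᶜ, F z := by rw [restrict_compl_singleton]
  have h1 : ∫⁻ z in {0}ᶜ, F z ≤ ∫⁻ z in A ∪ A2, F z := by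
    rw [← lintegral_indicator (measurableSet_singleton _).compl,
      ← lintegral_indicator (hAm.union hA2m)]
    refine lintegral_mono fun z => ?_
    by_cases hz : z ∈ ({0}ᶜ : Set (EuclideanSpace ℝ (Fin N)))
    · rw [Set.indicator_of_mem hz]
      by_cases hz2 : ‖z‖ < 2
      · have : z ∈ A ∪ A2 := by
          have hz0 : 0 < ‖z‖ := norm_pos_iff.2 hz
          rcases lt_or_ge ‖z‖ δ with h | h
          · exact Or.inl ⟨hz0, h⟩
          · exact Or.inr ⟨h, hz2⟩
        rw [Set.indicator_of_mem this]
      · have : F z = 0 := by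
          have : x + z ∉ unitBall N := by
            intro h
            unfold unitBall at h hx
            rw [mem_ball_zero_iff] at h hx
            have := norm_sub_le (x + z) x
            simp only [add_sub_cancel_left] at this
            linarith
          simp [hF, hf0 _ this]
        rw [this]; exact zero_le
    · rw [Set.indicator_of_notMem hz]; exact zero_le
  have h2 : ∫⁻ z in A, F z ≤ ENNReal.ofReal (δ ^ (1 - η)) * (∫⁻ z, f (x + z) ∂(kerMeas N η)) := by
    have hfx : Measurable fun z => f (x + z) := hf.comp (measurable_const_add x)
    rw [kerMeas, lintegral_withDensity_eq_lintegral_mul _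
      (by fun_prop : Measurable fun z : EuclideanSpace ℝ (Fin N) =>
        ENNReal.ofReal (‖z‖ ^ (η - N))) hfx, ← lintegral_const_mul _ (by
        exact Measurable.mul (by fun_prop) (hf.comp (measurable_const_add x)))]
    refine (setLIntegral_mono' hAm (g := fun z => ENNReal.ofReal (δ ^ (1 - η)) *
      (ENNReal.ofReal (‖z‖ ^ (η - N)) * f (x + z))) ?_).trans ?_
    · intro z hz
      simp only [hF]
      rw [mul_comm, ← mul_assoc]
      gcongr
      rw [← ENNReal.ofReal_mul (by positivity)]
      apply ENNReal.ofReal_le_ofReal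
      have : ‖z‖ ^ (1 - (N:ℝ)) = ‖z‖ ^ (1 - η) * ‖z‖ ^ (η - N) := by
        rw [← Real.rpow_add hz.1]; congr 1; ring
      rw [this]
      gcongr
      exact hz.2.le
    · refine lintegral_mono' (Measure.restrict_mono ?_ le_rfl) le_rfl
      intro z hz
      exact ⟨hz.1, by linarith [hz.2]⟩
  calc ∫⁻ z, F z ≤ ∫⁻ z in A ∪ A2, F z := h0.trans_le h1
    _ ≤ (∫⁻ z in A, F z) + ∫⁻ z in A2, F z := lintegral_union_le _ _ _
    _ ≤ _ := add_le_add h2 (far_bound N hN δ hδ hδ1 f hf hf1 x)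

lemma one_add_rpow_le (p q : ℝ) (hp : 0 < p) (hq : 1 < q) :
    ∃ C : ℝ, 0 ≤ C ∧ ∀ b : ℝ, 0 ≤ b → (1 + b) ^ p ≤ C + q * b ^ p := by
  set t := q ^ (1 / p) with ht
  have ht1 : 1 < t := Real.one_lt_rpow hq (by positivity)
  refine ⟨(1 + 1 / (t - 1)) ^ p, by have := sub_pos.2 ht1; positivity, fun b hb => ?_⟩
  have h1 := sub_pos.2 ht1
  rcases le_total (1 / (t - 1)) b with h | h
  · have h2 : 1 + b ≤ t * b := by
      rw [div_le_iff₀ h1] at h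
      linarith
    have h3 : (1 + b) ^ p ≤ (t * b) ^ p := Real.rpow_le_rpow (by positivity) h2 hp.le
    rw [Real.mul_rpow (by positivity) hb, ht, ← Real.rpow_mul (by linarith),
      one_div_mul_cancel hp.ne', Real.rpow_one] at h3
    have : 0 ≤ (1 + 1 / (t - 1)) ^ p := by positivity
    linarith
  · have h3 : (1 + b) ^ p ≤ (1 + 1 / (t - 1)) ^ p :=
      Real.rpow_le_rpow (by positivity) (by linarith) hp.le
    have : 0 ≤ q * b ^ p := by positivity
    linarith

lemma alphaMT_pos (N : ℕ) (hN : 2 ≤ N) : 0 < alphaMT N := by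
  have := sphereVol_pos N hN
  have : (0 : ℝ) < N := by exact_mod_cast (by omega : 0 < N)
  unfold alphaMT
  positivity

lemma scalar_bound (N : ℕ) (hN : 2 ≤ N) (γ : ℝ) (hγ : 0 < γ) (hγα : γ < alphaMT N) :
    ∃ η κ C : ℝ, 0 < η ∧ η < 1 ∧ 0 < κ ∧ κ < 1 ∧ 0 < C ∧ ∀ v G : ℝ, 0 ≤ v → 1 ≤ G →
      (∀ δ : ℝ, 0 < δ → δ ≤ 1 → sphereVol N * v ≤ δ ^ (1 - η) * G +
        (sphereVol N * Real.log (2 / δ)) ^ (1 / ((N : ℝ) / ((N : ℝ) - 1)))) →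
      Real.exp (γ * v ^ ((N : ℝ) / ((N : ℝ) - 1))) ≤ C * (G ^ (N:ℝ)) ^ κ := by
  have hN0 : (0:ℝ) < N := by exact_mod_cast (by omega : 0 < N)
  have hN2 : (2:ℝ) ≤ N := by exact_mod_cast hN
  have hω := sphereVol_pos N hN
  have hα := alphaMT_pos N hN
  set ω := sphereVol N with hωdef
  set p : ℝ := (N : ℝ) / ((N : ℝ) - 1) with hp
  have hp0 : 0 < p := div_pos hN0 (by linarith)
  set β := γ / alphaMT N with hβ
  have hβ0 : 0 < β := by positivity
  have hβ1 : β < 1 := (div_lt_one hα).2 hγα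
  set κ := (1 + β) / 2 with hκ
  have hκβ : 1 < κ / β := by rw [lt_div_iff₀ hβ0]; linarith
  set q := Real.sqrt (κ / β) with hq
  have hq1 : 1 < q := by rw [hq, Real.lt_sqrt (by norm_num)]; simpa using hκβ
  have hqq : β * (q * q) = κ := by
    rw [hq, Real.mul_self_sqrt (by linarith)]
    field_simp
  obtain ⟨C0, hC0, hC⟩ := one_add_rpow_le p q hp0 hq1
  have hγω : γ * (ω ^ p)⁻¹ * ω = N * β := by
    have h1 : ω ^ p = ω * ω ^ (1 / ((N:ℝ) - 1)) := by
      rw [← Real.rpow_one_add' hω.le]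
      · congr 1
        have : (N:ℝ) - 1 ≠ 0 := by linarith
        rw [hp]; field_simp; ring
      · have : 0 < 1 / ((N:ℝ) - 1) := by apply div_pos <;> linarith
        linarith
    have h2 : 0 < ω ^ (1 / ((N:ℝ) - 1)) := by positivity
    rw [h1, hβ, alphaMT, ← hωdef]
    field_simp
  refine ⟨1 - 1 / q, κ, Real.exp (γ * (ω ^ p)⁻¹ * (C0 + q * (ω * Real.log 2))), ?_, ?_, ?_, ?_,
    Real.exp_pos _, ?_⟩
  · have : 1 / q < 1 := by rw [div_lt_one (by linarith)]; exact hq1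
    linarith
  · have : 0 < 1 / q := by positivity
    linarith
  · linarith
  · linarith
  intro v G hv hG h
  have hG0 : 0 < G := by linarith
  have hlG : 0 ≤ Real.log G := Real.log_nonneg hG
  have hl2 : 0 ≤ Real.log 2 := Real.log_nonneg (by norm_num)
  have h1 := h (G ^ (-q)) (by positivity) (Real.rpow_le_one_of_one_le_of_nonpos hG (by linarith))
  have e1 : (G ^ (-q)) ^ (1 - (1 - 1 / q)) * G = 1 := by
    rw [← Real.rpow_mul hG0.le]
    have : -q * (1 - (1 - 1 / q)) = -1 := by field_simp; ring
    rw [this, Real.rpow_neg_one, inv_mul_cancel₀ hG0.ne']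
  have e2 : Real.log (2 / G ^ (-q)) = Real.log 2 + q * Real.log G := by
    rw [Real.log_div (by norm_num) (by positivity), Real.log_rpow hG0]; ring
  rw [e1, e2] at h1
  set b := (ω * (Real.log 2 + q * Real.log G)) ^ (1 / p) with hb
  have hb0 : 0 ≤ b := by positivity
  have hbp : b ^ p = ω * (Real.log 2 + q * Real.log G) := by
    rw [hb, ← Real.rpow_mul (by positivity), one_div_mul_cancel hp0.ne', Real.rpow_one]
  have h2 : (ω * v) ^ p ≤ C0 + q * b ^ p :=
    (Real.rpow_le_rpow (by positivity) h1 hp0.le).trans (hC b hb0)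
  rw [Real.mul_rpow hω.le hv, hbp] at h2
  have hωp : 0 < ω ^ p := by positivity
  have h3 : γ * v ^ p ≤ γ * (ω ^ p)⁻¹ * (C0 + q * (ω * Real.log 2)) + Real.log G * (N * κ) := by
    calc γ * v ^ p = γ * (ω ^ p)⁻¹ * (ω ^ p * v ^ p) := by field_simp
      _ ≤ γ * (ω ^ p)⁻¹ * (C0 + q * (ω * (Real.log 2 + q * Real.log G))) := by gcongr
      _ = γ * (ω ^ p)⁻¹ * (C0 + q * (ω * Real.log 2)) +
            (γ * (ω ^ p)⁻¹ * ω) * (q * q) * Real.log G := by ring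
      _ = _ := by rw [hγω, ← hqq]; ring
  calc Real.exp (γ * v ^ p) ≤ _ := Real.exp_le_exp.2 h3
    _ = _ := by
      rw [Real.exp_add, ← Real.rpow_mul hG0.le, Real.rpow_def_of_pos hG0]

/-- The volume density of the metric. -/
noncomputable def wgt (N : ℕ) (i : Fin N) (x : EuclideanSpace ℝ (Fin N)) : ℝ :=
  ((1 - ‖x‖)⁻¹) ^ (N + 1) / (1 + |x i| * Real.exp ((1 - ‖x‖)⁻¹))

lemma wgt_pos (N : ℕ) (i : Fin N) (x : EuclideanSpace ℝ (Fin N)) (hx : x ∈ unitBall N) :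
    0 < wgt N i x := by
  unfold unitBall at hx
  rw [mem_ball_zero_iff] at hx
  have : 0 < 1 - ‖x‖ := by linarith
  unfold wgt
  positivity

lemma wgt_cont (N : ℕ) (i : Fin N) : ContinuousOn (wgt N i) (unitBall N) := by
  have h : ContinuousOn (fun x : EuclideanSpace ℝ (Fin N) => (1 - ‖x‖)⁻¹) (unitBall N) := by
    apply ContinuousOn.inv₀ (by fun_prop)
    intro x hx
    unfold unitBall at hx
    rw [mem_ball_zero_iff] at hx
    linarith
  unfold wgt
  apply ContinuousOn.div (by fun_prop)
  · have : ContinuousOn (fun x : EuclideanSpace ℝ (Fin N) => |x i|) (unitBall N) := by fun_prop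
    exact continuousOn_const.add (this.mul h.rexp)
  · intro x hx
    positivity

lemma wgt_rpow_le (N : ℕ) (i : Fin N) (q : ℝ) (hq : 1 ≤ q) : ∃ C : ℝ, 0 ≤ C ∧
    ∀ x ∈ unitBall N, x i ≠ 0 → wgt N i x ^ q ≤ C * |x i| ^ (-(1/2) : ℝ) := by
  set θ : ℝ := 1 / (2 * q) with hθ
  have hθ0 : 0 < θ := by positivity
  have hθ1 : θ ≤ 1 := by
    rw [hθ, div_le_one (by positivity)]; linarith
  set C1 : ℝ := (N + 1).factorial / θ ^ (N + 1) with hC1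
  have hC10 : 0 ≤ C1 := by positivity
  refine ⟨C1 ^ q, by positivity, fun x hx hy => ?_⟩
  have hw := (wgt_pos N i x hx).le
  have hy0 : 0 < |x i| := abs_pos.2 hy
  have hd : 0 < 1 - ‖x‖ := by
    unfold unitBall at hx
    rw [mem_ball_zero_iff] at hx
    linarith
  set s := (1 - ‖x‖)⁻¹ with hs
  have hs0 : 0 < s := by positivity
  have h1 : s ^ (N + 1) ≤ C1 * Real.exp (θ * s) := by
    have := Real.pow_div_factorial_le_exp (θ * s) (by positivity) (N + 1)
    rw [div_le_iff₀ (by positivity), mul_pow] at this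
    rw [hC1, div_mul_eq_mul_div, le_div_iff₀ (by positivity)]
    linarith
  have h2 : (|x i| * Real.exp s) ^ θ ≤ 1 + |x i| * Real.exp s := by
    have h0 : 0 ≤ |x i| * Real.exp s := by positivity
    calc (|x i| * Real.exp s) ^ θ ≤ (1 + |x i| * Real.exp s) ^ θ :=
          Real.rpow_le_rpow h0 (by linarith) hθ0.le
      _ ≤ (1 + |x i| * Real.exp s) ^ (1:ℝ) :=
          Real.rpow_le_rpow_of_exponent_le (by linarith) hθ1
      _ = _ := Real.rpow_one _
  have h3 : (|x i| * Real.exp s) ^ θ = |x i| ^ θ * Real.exp (θ * s) := by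
    rw [Real.mul_rpow hy0.le (Real.exp_pos _).le, ← Real.exp_mul, mul_comm s]
  have h4 : wgt N i x ≤ C1 * |x i| ^ (-θ) := by
    unfold wgt
    rw [← hs, div_le_iff₀ (by positivity)]
    calc s ^ (N + 1) ≤ C1 * Real.exp (θ * s) := h1
      _ = C1 * |x i| ^ (-θ) * (|x i| ^ θ * Real.exp (θ * s)) := by
        rw [Real.rpow_neg hy0.le]
        have : 0 < |x i| ^ θ := by positivity
        field_simp
      _ ≤ _ := by rw [← h3]; gcongr
  calc wgt N i x ^ q ≤ (C1 * |x i| ^ (-θ)) ^ q := Real.rpow_le_rpow hw h4 (by linarith)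
    _ = _ := by
      rw [Real.mul_rpow hC10 (by positivity), ← Real.rpow_mul hy0.le]
      congr 2
      rw [hθ]; field_simp

lemma lintegral_coord (N : ℕ) (i : Fin N) :
    ∫⁻ x : EuclideanSpace ℝ (Fin N) in unitBall N, ENNReal.ofReal (|x i| ^ (-(1/2) : ℝ)) < ⊤ := by
  set φ : Fin N → ℝ → ℝ := fun j t => if j = i then
    (Set.Icc (-1:ℝ) 1).indicator (fun t => |t| ^ (-(1/2) : ℝ)) t else (Set.Icc (-1:ℝ) 1).indicator 1 t with hφ
  have hI : ∀ j, Integrable (φ j) volume := by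
    intro j
    by_cases hj : j = i
    · simp only [hφ, hj, if_true]
      change Integrable ((Set.Icc (-1:ℝ) 1).indicator (fun t => |t| ^ (-(1/2) : ℝ))) volume
      rw [integrable_indicator_iff measurableSet_Icc, integrableOn_Icc_iff_integrableOn_Ioc,
        ← intervalIntegrable_iff_integrableOn_Ioc_of_le (by norm_num)]
      have h1 : IntervalIntegrable (fun t : ℝ => |t| ^ (-(1/2) : ℝ)) volume 0 1 := by
        refine (intervalIntegral.intervalIntegrable_rpow' (r := -(1/2)) (by norm_num)).congr ?_
        intro t ht
        rw [Set.uIoc_of_le (by norm_num)] at ht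
        simp only [abs_of_pos ht.1]
      have h2 : IntervalIntegrable (fun t : ℝ => |t| ^ (-(1/2) : ℝ)) volume (-1) 0 := by
        rw [IntervalIntegrable.iff_comp_neg]
        simp only [abs_neg, neg_zero, neg_neg]
        exact h1.symm
      exact h2.trans h1
    · simp only [hφ, hj, if_false]
      change Integrable ((Set.Icc (-1:ℝ) 1).indicator 1) volume
      rw [integrable_indicator_iff measurableSet_Icc]
      exact integrableOn_const (by simp)
  have hP := Integrable.fintype_prod hI
  have hP2 := (PiLp.volume_preserving_ofLp (Fin N)).integrable_comp_of_integrable hP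
  refine lt_of_le_of_lt ?_ hP2.lintegral_lt_top
  rw [← lintegral_indicator (by exact measurableSet_ball)]
  refine lintegral_mono fun x => ?_
  by_cases hx : x ∈ unitBall N
  · rw [Set.indicator_of_mem hx]
    apply ENNReal.ofReal_le_ofReal
    have hc : ∀ j, x j ∈ Set.Icc (-1:ℝ) 1 := by
      intro j
      unfold unitBall at hx
      rw [mem_ball_zero_iff] at hx
      have := PiLp.norm_apply_le x j
      rw [Real.norm_eq_abs] at this
      exact abs_le.1 (by linarith)
    have : ∀ j, φ j (x j) = if j = i then |x j| ^ (-(1/2) : ℝ) else 1 := by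
      intro j
      simp only [hφ, Set.indicator_of_mem (hc j), Pi.one_apply]
    change _ ≤ ∏ j, φ j (x j)
    simp [this]
  · rw [Set.indicator_of_notMem hx]; exact zero_le

lemma ae_coord_ne (N : ℕ) (i : Fin N) :
    ∀ᵐ x : EuclideanSpace ℝ (Fin N), x i ≠ 0 := by
  have h : ∀ᵐ x : Fin N → ℝ, x i ≠ 0 := Measure.ae_eval_ne _ i 0
  exact (PiLp.volume_preserving_ofLp (Fin N)).quasiMeasurePreserving.ae h

lemma wgt_Lq (N : ℕ) (i : Fin N) (q : ℝ) (hq : 1 ≤ q) :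
    ∫⁻ x in unitBall N, ENNReal.ofReal (wgt N i x ^ q) < ⊤ := by
  obtain ⟨C, hC0, hC⟩ := wgt_rpow_le N i q hq
  have : ∫⁻ x in unitBall N, ENNReal.ofReal (wgt N i x ^ q) ≤
      ∫⁻ x : EuclideanSpace ℝ (Fin N) in unitBall N,
        ENNReal.ofReal C * ENNReal.ofReal (|x i| ^ (-(1/2) : ℝ)) := by
    refine lintegral_mono_ae ?_
    filter_upwards [ae_restrict_mem (by exact measurableSet_ball), ae_restrict_of_ae (ae_coord_ne N i)]
      with x hx hy
    rw [← ENNReal.ofReal_mul hC0]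
    exact ENNReal.ofReal_le_ofReal (hC x hx hy)
  refine this.trans_lt ?_
  rw [lintegral_const_mul' _ _ ENNReal.ofReal_ne_top]
  exact ENNReal.mul_lt_top ENNReal.ofReal_lt_top (lintegral_coord N i)

lemma PhiGamma_eq (N : ℕ) (_hN : 2 ≤ N) (γ t : ℝ) :
    PhiGamma N γ t = Real.exp (γ * |t| ^ ((N : ℝ) / ((N : ℝ) - 1))) -
      ∑ j ∈ Finset.range (N - 1),
        (γ * |t| ^ ((N : ℝ) / ((N : ℝ) - 1))) ^ j / (Nat.factorial j : ℝ) := by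
  unfold PhiGamma
  congr 1
  refine Finset.sum_congr rfl fun j _ => ?_
  rw [mul_pow, ← Real.rpow_mul_natCast (abs_nonneg t)]
  congr 3
  ring

lemma PhiGamma_nonneg (N : ℕ) (hN : 2 ≤ N) (γ t : ℝ) (hγ : 0 < γ) : 0 ≤ PhiGamma N γ t := by
  rw [PhiGamma_eq N hN]
  have := Real.sum_le_exp_of_nonneg (x := γ * |t| ^ ((N : ℝ) / ((N : ℝ) - 1))) (by positivity) (N - 1)
  linarith

lemma PhiGamma_le (N : ℕ) (hN : 2 ≤ N) (γ t : ℝ) (hγ : 0 < γ) :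
    PhiGamma N γ t ≤ Real.exp (γ * |t| ^ ((N : ℝ) / ((N : ℝ) - 1))) := by
  rw [PhiGamma_eq N hN]
  have : 0 ≤ ∑ j ∈ Finset.range (N - 1),
        (γ * |t| ^ ((N : ℝ) / ((N : ℝ) - 1))) ^ j / (Nat.factorial j : ℝ) :=
    Finset.sum_nonneg fun j _ => by positivity
  linarith

lemma fderiv_zero_off (N : ℕ) (u : EuclideanSpace ℝ (Fin N) → ℝ) (hu : IsTest (unitBall N) u)
    (x : EuclideanSpace ℝ (Fin N)) (hx : x ∉ unitBall N) : fderiv ℝ u x = 0 := by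
  by_contra h
  exact hx (hu.2.2 (support_fderiv_subset ℝ (by simpa using h)))

lemma energy_lintegral (N : ℕ) (hN : 2 ≤ N) (u : EuclideanSpace ℝ (Fin N) → ℝ)
    (hu : IsTest (unitBall N) u) (hE : (∫ x in unitBall N, ‖fderiv ℝ u x‖ ^ N) ≤ 1) :
    ∫⁻ x, ‖fderiv ℝ u x‖ₑ ^ (N:ℝ) ≤ 1 := by
  have hfc : Continuous (fderiv ℝ u) := hu.1.continuous_fderiv (by simp)
  have hcs : HasCompactSupport (fderiv ℝ u) := hu.2.1.fderiv ℝ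
  have hint : Integrable (fun x => ‖fderiv ℝ u x‖ ^ N) := by
    apply Continuous.integrable_of_hasCompactSupport (by fun_prop)
    exact hcs.comp_left (g := fun v => ‖v‖ ^ N) (by simp; omega)
  have h1 : ∫ x in unitBall N, ‖fderiv ℝ u x‖ ^ N = ∫ x, ‖fderiv ℝ u x‖ ^ N := by
    apply setIntegral_eq_integral_of_forall_compl_eq_zero
    intro x hx
    rw [fderiv_zero_off N u hu x hx]
    simp; omega
  rw [h1] at hE
  have h2 := ofReal_integral_eq_lintegral_ofReal hint (ae_of_all _ fun x => by positivity)
  have h3 : ∀ x, ‖fderiv ℝ u x‖ₑ ^ (N:ℝ) = ENNReal.ofReal (‖fderiv ℝ u x‖ ^ N) := by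
    intro x
    rw [ENNReal.ofReal_pow (norm_nonneg _), ofReal_norm, ENNReal.rpow_natCast]
  rw [lintegral_congr h3, ← h2]
  exact ENNReal.ofReal_le_one.2 hE

lemma rpow_mul_le_add (a w κ : ℝ) (ha : 0 ≤ a) (hw : 0 ≤ w) (hκ : 0 < κ) (hκ1 : κ < 1) :
    a ^ κ * w ≤ a + w ^ (1 / (1 - κ)) := by
  have h1 : 0 < 1 - κ := by linarith
  have hq : (w ^ (1 / (1 - κ))) ^ (1 - κ) = w := by
    rw [← Real.rpow_mul hw, one_div_mul_cancel h1.ne', Real.rpow_one]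
  set W := w ^ (1 / (1 - κ)) with hW
  have hW0 : 0 ≤ W := by positivity
  have := Real.geom_mean_le_arith_mean2_weighted hκ.le h1.le ha hW0 (by ring)
  rw [hq] at this
  nlinarith

lemma upper (N : ℕ) (hN : 2 ≤ N) (i : Fin N) (γ : ℝ) (hγ : 0 < γ) (hγα : γ < alphaMT N) :
    ∃ M : ℝ, ∀ u : EuclideanSpace ℝ (Fin N) → ℝ, IsTest (unitBall N) u →
      (∫ x in unitBall N, ‖fderiv ℝ u x‖ ^ N) ≤ 1 →
      ∫ x in unitBall N, PhiGamma N γ (u x) * wgt N i x ≤ M := by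
  obtain ⟨η, κ, C, hη, hη1, hκ, hκ1, hC, hS⟩ := scalar_bound N hN γ hγ hγα
  have hN0 : (0:ℝ) < N := by exact_mod_cast (by omega : 0 < N)
  have hωp := sphereVol_pos N hN
  set Y : ENNReal := (kerMeas N η Set.univ) ^ ((1 / ((N : ℝ) / ((N : ℝ) - 1))) * N) *
    kerMeas N η Set.univ with hY
  have hνfin := kerMeas_univ_lt_top N hN η hη
  have hYfin : Y < ⊤ := by
    refine ENNReal.mul_lt_top (ENNReal.rpow_lt_top_of_nonneg ?_ hνfin.ne) hνfin
    have := (holderConj N hN).symm.nonneg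
    positivity
  set Z : ENNReal := ENNReal.ofReal C * ((volume (unitBall N) + Y) +
    ∫⁻ x in unitBall N, ENNReal.ofReal (wgt N i x ^ (1 / (1 - κ)))) with hZ
  have hZfin : Z < ⊤ := by
    refine ENNReal.mul_lt_top ENNReal.ofReal_lt_top (ENNReal.add_lt_top.2
      ⟨ENNReal.add_lt_top.2 ⟨measure_ball_lt_top, hYfin⟩, wgt_Lq N i _ ?_⟩)
    rw [le_div_iff₀ (by linarith)]; linarith
  refine ⟨Z.toReal, fun u hu hE => ?_⟩
  have hfc : Continuous (fderiv ℝ u) := hu.1.continuous_fderiv (by simp)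
  have hcs : HasCompactSupport (fderiv ℝ u) := hu.2.1.fderiv ℝ
  have hEl := energy_lintegral N hN u hu hE
  set f : EuclideanSpace ℝ (Fin N) → ENNReal := fun x => ‖fderiv ℝ u x‖ₑ with hf
  have hfm : Measurable f := hfc.enorm.measurable
  have hf0 : ∀ x, x ∉ unitBall N → f x = 0 := by
    intro x hx
    simp only [hf, fderiv_zero_off N u hu x hx]
    rw [← ofReal_norm, norm_zero, ENNReal.ofReal_zero]
  obtain ⟨b, hb⟩ := hcs.exists_bound_of_continuous hfc
  set g : EuclideanSpace ℝ (Fin N) → ENNReal := fun x => ∫⁻ z, f (x + z) ∂(kerMeas N η) with hg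
  have hgm : Measurable g := by
    have : SFinite (kerMeas N η) := by unfold kerMeas; infer_instance
    have hm : Measurable (Function.uncurry fun (x z : EuclideanSpace ℝ (Fin N)) => f (x + z)) :=
      hfm.comp measurable_add
    exact hm.lintegral_prod_right
  have hgfin : ∀ x, g x < ⊤ := by
    intro x
    have : g x ≤ ∫⁻ z, ENNReal.ofReal b ∂(kerMeas N η) := by
      refine lintegral_mono fun z => ?_
      simp only [hf]
      rw [← ofReal_norm]
      exact ENNReal.ofReal_le_ofReal (hb _)
    refine this.trans_lt ?_
    rw [lintegral_const]
    exact ENNReal.mul_lt_top ENNReal.ofReal_lt_top hνfin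
  -- pointwise bound
  have hpt : ∀ x ∈ unitBall N, ENNReal.ofReal ‖PhiGamma N γ (u x) * wgt N i x‖ ≤
      ENNReal.ofReal C * ((1 + g x ^ (N:ℝ)) + ENNReal.ofReal (wgt N i x ^ (1 / (1 - κ)))) := by
    intro x hx
    have hw := (wgt_pos N i x hx).le
    set G := max 1 (g x).toReal with hG
    have hG1 : 1 ≤ G := le_max_left _ _
    have hexp := hS |u x| G (abs_nonneg _) hG1 (by
      intro δ hδ hδ1
      have h1 := (representation N hN u hu.1 hu.2.1 x).trans
        (hedberg N hN η hη hη1 δ hδ hδ1 f hfm hEl hf0 x hx)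
      have h2 : g x = ENNReal.ofReal (g x).toReal := (ENNReal.ofReal_toReal (hgfin x).ne).symm
      change _ ≤ ENNReal.ofReal (δ ^ (1 - η)) * g x + _ at h1
      have hlog : 0 ≤ Real.log (2 / δ) := Real.log_nonneg (by rw [le_div_iff₀ hδ]; linarith)
      rw [h2, ← ENNReal.ofReal_mul (by positivity),
        ← ENNReal.ofReal_add (by positivity) (by positivity),
        ENNReal.ofReal_le_ofReal_iff (by positivity)] at h1
      refine h1.trans ?_
      gcongr
      exact le_max_right _ _)
    have hGN : ENNReal.ofReal (G ^ (N:ℝ)) ≤ 1 + g x ^ (N:ℝ) := by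
      rcases le_total 1 (g x).toReal with h | h
      · rw [hG, max_eq_right h, ← ENNReal.ofReal_rpow_of_nonneg (by positivity) hN0.le,
          ENNReal.ofReal_toReal (hgfin x).ne]
        exact le_add_self
      · rw [hG, max_eq_left h]
        simp
    calc ENNReal.ofReal ‖PhiGamma N γ (u x) * wgt N i x‖
        ≤ ENNReal.ofReal (C * (G ^ (N:ℝ) + wgt N i x ^ (1 / (1 - κ)))) := by
          apply ENNReal.ofReal_le_ofReal
          rw [Real.norm_of_nonneg (mul_nonneg (PhiGamma_nonneg N hN γ _ hγ) hw)]
          calc PhiGamma N γ (u x) * wgt N i x ≤ (C * (G ^ (N:ℝ)) ^ κ) * wgt N i x := by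
                gcongr
                exact (PhiGamma_le N hN γ _ hγ).trans hexp
            _ = C * ((G ^ (N:ℝ)) ^ κ * wgt N i x) := by ring
            _ ≤ _ := by
                gcongr
                exact rpow_mul_le_add _ _ κ (by positivity) hw hκ hκ1
      _ = ENNReal.ofReal C * (ENNReal.ofReal (G ^ (N:ℝ)) +
            ENNReal.ofReal (wgt N i x ^ (1 / (1 - κ)))) := by
          rw [ENNReal.ofReal_mul hC.le, ENNReal.ofReal_add (by positivity) (by positivity)]
      _ ≤ _ := by gcongr
  have hmain : ∫⁻ x in unitBall N, ENNReal.ofReal ‖PhiGamma N γ (u x) * wgt N i x‖ ≤ Z := by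
    refine (setLIntegral_mono' (by exact measurableSet_ball) hpt).trans ?_
    rw [lintegral_const_mul' _ _ ENNReal.ofReal_ne_top, hZ]
    gcongr
    rw [lintegral_add_left (by fun_prop), lintegral_add_left (by fun_prop)]
    gcongr
    · simp
    · exact (setLIntegral_le_lintegral _ _).trans (young_bound N hN η hη f hfm hEl)
  calc ∫ x in unitBall N, PhiGamma N γ (u x) * wgt N i x
      ≤ ‖∫ x in unitBall N, PhiGamma N γ (u x) * wgt N i x‖ := Real.le_norm_self _
    _ ≤ (∫⁻ x in unitBall N, ENNReal.ofReal ‖PhiGamma N γ (u x) * wgt N i x‖).toReal :=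
        norm_integral_le_lintegral_norm _
    _ ≤ Z.toReal := ENNReal.toReal_mono hZfin.ne hmain

/-- A smooth substitute of the positive part. -/
noncomputable def hfun (σ : ℝ) : ℝ := σ * expNegInvGlue σ

lemma hfun_contDiff : ContDiff ℝ (⊤ : ℕ∞) hfun :=
  contDiff_id.mul expNegInvGlue.contDiff

lemma hfun_of_nonpos {σ : ℝ} (h : σ ≤ 0) : hfun σ = 0 := by
  simp [hfun, expNegInvGlue.zero_of_nonpos h]

lemma hfun_eq {σ : ℝ} (h : 0 < σ) : hfun σ = σ * Real.exp (-σ⁻¹) := by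
  simp [hfun, expNegInvGlue, not_le.2 h]

lemma hfun_ge (σ : ℝ) : σ - 1 ≤ hfun σ := by
  rcases le_or_gt σ 0 with h | h
  · rw [hfun_of_nonpos h]; linarith
  · rw [hfun_eq h]
    have h1 := Real.add_one_le_exp (-σ⁻¹)
    have h2 : σ * (-σ⁻¹ + 1) ≤ σ * Real.exp (-σ⁻¹) := by gcongr
    have h3 : σ * (-σ⁻¹ + 1) = σ - 1 := by field_simp; ring
    linarith

lemma hfun_deriv (σ : ℝ) : |deriv hfun σ| ≤ 1 := by
  rcases lt_trichotomy σ 0 with h | h | h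
  · have : hfun =ᶠ[nhds σ] fun _ => 0 := by
      filter_upwards [Iio_mem_nhds h] with t ht
      exact hfun_of_nonpos (le_of_lt ht)
    rw [this.deriv_eq]; simp
  · subst h
    have hd : DifferentiableAt ℝ expNegInvGlue 0 :=
      (expNegInvGlue.contDiff (n := 1)).differentiable (by simp) 0
    have : HasDerivAt hfun (1 * expNegInvGlue 0 + 0 * deriv expNegInvGlue 0) 0 :=
      (hasDerivAt_id (0:ℝ)).mul hd.hasDerivAt
    rw [this.deriv]; simp [expNegInvGlue.zero]
  · have he : hfun =ᶠ[nhds σ] fun t => t * Real.exp (-t⁻¹) := by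
      filter_upwards [Ioi_mem_nhds h] with t ht
      exact hfun_eq ht
    have hd : HasDerivAt (fun t : ℝ => t * Real.exp (-t⁻¹))
        (1 * Real.exp (-σ⁻¹) + σ * (Real.exp (-σ⁻¹) * (-(-(σ ^ 2)⁻¹)))) σ :=
      (hasDerivAt_id σ).mul ((hasDerivAt_inv h.ne').neg.exp)
    rw [he.deriv_eq, hd.deriv]
    have e : 1 * Real.exp (-σ⁻¹) + σ * (Real.exp (-σ⁻¹) * (-(-(σ ^ 2)⁻¹))) =
        Real.exp (-σ⁻¹) * (σ⁻¹ + 1) := by field_simp; ring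
    rw [e, abs_of_nonneg (by positivity), Real.exp_neg, inv_mul_le_iff₀ (Real.exp_pos _), mul_one]
    exact Real.add_one_le_exp _

lemma lintegral_log (R ε : ℝ) (hR : 0 < R) (hε : 0 < ε) (hεR : ε < R) :
    ∫⁻ r in Set.Ioc 0 R, ENNReal.ofReal (r / (r ^ 2 + ε ^ 2)) ≤
      ENNReal.ofReal (1 + Real.log (R / ε)) := by
  have hd : ∀ r ∈ Set.uIcc 0 R, HasDerivAt (fun r : ℝ => Real.log (r ^ 2 + ε ^ 2) / 2)
      (r / (r ^ 2 + ε ^ 2)) r := by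
    intro r _
    have h1 : HasDerivAt (fun r : ℝ => r ^ 2 + ε ^ 2) (2 * r) r := by
      simpa using (hasDerivAt_pow 2 r).add_const (ε ^ 2)
    have h2 := (h1.log (by positivity)).div_const 2
    have e : r / (r ^ 2 + ε ^ 2) = 2 * r / (r ^ 2 + ε ^ 2) / 2 := by ring
    rw [e]
    exact h2
  have hc : Continuous fun r : ℝ => r / (r ^ 2 + ε ^ 2) := by
    apply Continuous.div (by fun_prop) (by fun_prop)
    intro r; positivity
  have hI := intervalIntegral.integral_eq_sub_of_hasDerivAt hd (hc.intervalIntegrable _ _)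
  rw [← ofReal_integral_eq_lintegral_ofReal (hc.intervalIntegrable 0 R).1,
    ← intervalIntegral.integral_of_le hR.le, hI]
  · apply ENNReal.ofReal_le_ofReal
    have h1 : Real.log (R ^ 2 + ε ^ 2) ≤ Real.log 2 + 2 * Real.log R := by
      rw [show 2 * Real.log R = Real.log (R ^ 2) by rw [Real.log_pow]; norm_num,
        ← Real.log_mul (by norm_num) (by positivity)]
      apply Real.log_le_log (by positivity)
      nlinarith
    have h2 : Real.log (0 ^ 2 + ε ^ 2) = 2 * Real.log ε := by
      rw [show (0:ℝ) ^ 2 + ε ^ 2 = ε ^ 2 by ring, Real.log_pow]; norm_num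
    have h3 : Real.log 2 ≤ 1 := by have := Real.log_two_lt_d9; linarith
    rw [h2, Real.log_div hR.ne' hε.ne']
    linarith
  · filter_upwards [ae_restrict_mem measurableSet_Ioc] with r hr
    have := hr.1
    positivity

/-- Smoothed Moser function. -/
noncomputable def moserFun (N : ℕ) (x0 : EuclideanSpace ℝ (Fin N)) (R ε c : ℝ)
    (x : EuclideanSpace ℝ (Fin N)) : ℝ :=
  c * hfun (Real.log R - Real.log (‖x - x0‖ ^ 2 + ε ^ 2) / 2)

lemma moserFun_contDiff (N : ℕ) (x0 : EuclideanSpace ℝ (Fin N)) (R ε c : ℝ) (hε : 0 < ε) :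
    ContDiff ℝ (⊤ : ℕ∞) (moserFun N x0 R ε c) := by
  unfold moserFun
  have h1 : ContDiff ℝ (⊤ : ℕ∞) fun x : EuclideanSpace ℝ (Fin N) => ‖x - x0‖ ^ 2 + ε ^ 2 :=
    ((contDiff_id.sub contDiff_const).norm_sq ℝ).add contDiff_const
  have h2 := h1.log (fun x => by positivity)
  exact contDiff_const.mul (hfun_contDiff.comp (contDiff_const.sub (h2.div_const 2)))

lemma moserFun_zero (N : ℕ) (x0 : EuclideanSpace ℝ (Fin N)) (R ε c : ℝ) (hR : 0 < R) (hε : 0 < ε)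
    (x : EuclideanSpace ℝ (Fin N)) (hx : x ∉ Metric.closedBall x0 R) :
    moserFun N x0 R ε c x = 0 := by
  rw [mem_closedBall_iff_norm, not_le] at hx
  unfold moserFun
  rw [hfun_of_nonpos, mul_zero]
  have : Real.log (R ^ 2) ≤ Real.log (‖x - x0‖ ^ 2 + ε ^ 2) := by
    apply Real.log_le_log (by positivity)
    nlinarith
  rw [Real.log_pow] at this
  push_cast at this
  linarith

lemma moserFun_tsupport (N : ℕ) (x0 : EuclideanSpace ℝ (Fin N)) (R ε c : ℝ) (hR : 0 < R)
    (hε : 0 < ε) : tsupport (moserFun N x0 R ε c) ⊆ Metric.closedBall x0 R := by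
  apply closure_minimal _ Metric.isClosed_closedBall
  intro x hx
  by_contra h
  exact hx (moserFun_zero N x0 R ε c hR hε x h)

lemma moserFun_fderiv (N : ℕ) (x0 : EuclideanSpace ℝ (Fin N)) (R ε c : ℝ) (hε : 0 < ε)
    (hc : 0 ≤ c) (x : EuclideanSpace ℝ (Fin N)) :
    ‖fderiv ℝ (moserFun N x0 R ε c) x‖ ≤ c * (‖x - x0‖ / (‖x - x0‖ ^ 2 + ε ^ 2)) := by
  have h1 : HasFDerivAt (fun x : EuclideanSpace ℝ (Fin N) => ‖x - x0‖ ^ 2 + ε ^ 2)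
      (2 • (innerSL ℝ (x - x0))) x := by
    have := ((hasStrictFDerivAt_norm_sq (x - x0)).hasFDerivAt.comp x
      ((hasFDerivAt_id x).sub_const x0)).add_const (ε ^ 2)
    simpa [Function.comp_def] using this
  have hpos : 0 < ‖x - x0‖ ^ 2 + ε ^ 2 := by positivity
  have h2 := ((h1.log hpos.ne').mul_const (1 / 2 : ℝ)).const_sub (Real.log R)
  have hh : HasDerivAt hfun (deriv hfun (Real.log R - Real.log (‖x - x0‖ ^ 2 + ε ^ 2) * (1 / 2)))
      (Real.log R - Real.log (‖x - x0‖ ^ 2 + ε ^ 2) * (1 / 2)) :=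
    (hfun_contDiff.differentiable (by simp) _).hasDerivAt
  have h3 := (hh.comp_hasFDerivAt x h2).const_mul c
  have h4 : moserFun N x0 R ε c = fun x => c * (hfun ∘ fun x =>
      Real.log R - Real.log (‖x - x0‖ ^ 2 + ε ^ 2) * (1 / 2)) x := by
    funext x
    simp only [moserFun, Function.comp, mul_one_div]
  rw [h4, h3.fderiv, norm_smul, norm_smul, norm_neg, norm_smul, norm_smul, Real.norm_of_nonneg hc]
  have h5 : ‖(2 • (innerSL ℝ (x - x0)) : EuclideanSpace ℝ (Fin N) →L[ℝ] ℝ)‖ = 2 * ‖x - x0‖ := by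
    rw [← Nat.cast_smul_eq_nsmul ℝ, norm_smul, innerSL_apply_norm]
    simp
  rw [h5]
  gcongr
  have h6 := hfun_deriv (Real.log R - Real.log (‖x - x0‖ ^ 2 + ε ^ 2) * (1 / 2))
  rw [Real.norm_eq_abs]
  have h7 : ‖(1 / 2 : ℝ)‖ * (‖(‖x - x0‖ ^ 2 + ε ^ 2)⁻¹‖ * (2 * ‖x - x0‖)) =
      ‖x - x0‖ / (‖x - x0‖ ^ 2 + ε ^ 2) := by
    rw [norm_inv, Real.norm_of_nonneg hpos.le, Real.norm_of_nonneg (by norm_num)]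
    field_simp
  rw [h7]
  exact mul_le_of_le_one_left (by positivity) h6

lemma moser_energy (N : ℕ) (hN : 2 ≤ N) (x0 : EuclideanSpace ℝ (Fin N)) (R ε c : ℝ) (hε : 0 < ε)
    (hεR : ε < R) (hc : 0 ≤ c) (hcN : sphereVol N * c ^ N * (1 + Real.log (R / ε)) ≤ 1) :
    ∫ x in unitBall N, ‖fderiv ℝ (moserFun N x0 R ε c) x‖ ^ N ≤ 1 := by
  have hR : 0 < R := hε.trans hεR
  have hω := sphereVol_pos N hN
  have hL : 0 ≤ Real.log (R / ε) := Real.log_nonneg (by rw [le_div_iff₀ hε]; linarith)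
  set D : ℝ → ENNReal := (Set.Iic R).indicator
    fun r => ENNReal.ofReal ((c * (r / (r ^ 2 + ε ^ 2))) ^ N) with hD
  have hDm : Measurable D := Measurable.indicator (by fun_prop) measurableSet_Iic
  have hb : ∀ x, ENNReal.ofReal ‖‖fderiv ℝ (moserFun N x0 R ε c) x‖ ^ N‖ ≤ D ‖x - x0‖ := by
    intro x
    rw [Real.norm_of_nonneg (by positivity)]
    by_cases hx : x ∈ Metric.closedBall x0 R
    · have : ‖x - x0‖ ∈ Set.Iic R := by rwa [mem_closedBall_iff_norm] at hx
      rw [hD, Set.indicator_of_mem this]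
      apply ENNReal.ofReal_le_ofReal
      gcongr
      exact moserFun_fderiv N x0 R ε c hε hc x
    · have : fderiv ℝ (moserFun N x0 R ε c) x = 0 := by
        by_contra h
        exact hx (moserFun_tsupport N x0 R ε c hR hε (support_fderiv_subset ℝ (by simpa using h)))
      rw [this, norm_zero, zero_pow (by omega)]
      simp
  have h1 : ∫⁻ x, D ‖x - x0‖ ≤ 1 := by
    have e1 : ∫⁻ x : EuclideanSpace ℝ (Fin N), D ‖x - x0‖ = ∫⁻ x : EuclideanSpace ℝ (Fin N), D ‖x‖ :=
      lintegral_sub_right_eq_self (fun x : EuclideanSpace ℝ (Fin N) => D ‖x‖) x0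
    rw [e1, lintegral_radial N hN D hDm]
    have e2 : ∫⁻ r in Set.Ioi (0:ℝ), ENNReal.ofReal (r ^ (N - 1)) * D r ≤
        ∫⁻ r in Set.Ioc 0 R, ENNReal.ofReal (c ^ N) * ENNReal.ofReal (r / (r ^ 2 + ε ^ 2)) := by
      rw [← lintegral_indicator measurableSet_Ioi, ← lintegral_indicator measurableSet_Ioc]
      refine lintegral_mono fun r => ?_
      by_cases h0 : r ∈ Set.Ioi (0:ℝ)
      · rw [Set.indicator_of_mem h0]
        have h0' : 0 < r := h0
        by_cases hr : r ∈ Set.Iic R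
        · have hm : r ∈ Set.Ioc 0 R := ⟨h0, hr⟩
          rw [hD, Set.indicator_of_mem hr, Set.indicator_of_mem hm,
            ← ENNReal.ofReal_mul (by positivity), ← ENNReal.ofReal_mul (by positivity)]
          apply ENNReal.ofReal_le_ofReal
          obtain ⟨n, rfl⟩ : ∃ n, N = n + 1 := ⟨N - 1, by omega⟩
          simp only [Nat.add_sub_cancel]
          have hle : (r * (r / (r ^ 2 + ε ^ 2))) ^ n ≤ 1 := by
            apply pow_le_one₀ (by positivity)
            rw [← mul_div_assoc, div_le_one (by positivity)]
            nlinarith [sq_nonneg ε]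
          calc r ^ n * (c * (r / (r ^ 2 + ε ^ 2))) ^ (n + 1)
              = c ^ (n + 1) * (r / (r ^ 2 + ε ^ 2)) * (r * (r / (r ^ 2 + ε ^ 2))) ^ n := by
                rw [mul_pow, mul_pow, pow_succ (r / _)]; ring
            _ ≤ c ^ (n + 1) * (r / (r ^ 2 + ε ^ 2)) * 1 := by gcongr
            _ = _ := mul_one _
        · rw [hD, Set.indicator_of_notMem hr]; simp
      · rw [Set.indicator_of_notMem h0]; exact zero_le
    rw [lintegral_const_mul' _ _ ENNReal.ofReal_ne_top] at e2
    calc _ ≤ ENNReal.ofReal (sphereVol N) * (ENNReal.ofReal (c ^ N) *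
          ENNReal.ofReal (1 + Real.log (R / ε))) := by
          gcongr
          refine e2.trans ?_
          gcongr
          exact lintegral_log R ε hR hε hεR
      _ = ENNReal.ofReal (sphereVol N * c ^ N * (1 + Real.log (R / ε))) := by
          rw [← ENNReal.ofReal_mul (by positivity), ← ENNReal.ofReal_mul hω.le, mul_assoc]
      _ ≤ 1 := ENNReal.ofReal_le_one.2 hcN
  calc _ ≤ ‖∫ x in unitBall N, ‖fderiv ℝ (moserFun N x0 R ε c) x‖ ^ N‖ := Real.le_norm_self _
    _ ≤ (∫⁻ x in unitBall N, ENNReal.ofReal ‖‖fderiv ℝ (moserFun N x0 R ε c) x‖ ^ N‖).toReal :=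
        norm_integral_le_lintegral_norm _
    _ ≤ (1 : ENNReal).toReal := by
        apply ENNReal.toReal_mono ENNReal.one_ne_top
        exact (setLIntegral_le_lintegral _ _).trans ((lintegral_mono hb).trans h1)
    _ = 1 := by simp

lemma moser_exists (N : ℕ) (hN : 2 ≤ N) (x0 : EuclideanSpace ℝ (Fin N)) (R ε : ℝ) (hε : 0 < ε)
    (hεR : ε < R) (hB : Metric.closedBall x0 R ⊆ unitBall N) (hL : 2 ≤ Real.log (R / ε)) :
    ∃ u, IsTest (unitBall N) u ∧ (∫ x in unitBall N, ‖fderiv ℝ u x‖ ^ N) ≤ 1 ∧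
      ∀ x ∈ Metric.ball x0 ε, N * (Real.log (R / ε) - 5) ≤
        alphaMT N * |u x| ^ ((N : ℝ) / ((N : ℝ) - 1)) := by
  have hR : 0 < R := hε.trans hεR
  have hω := sphereVol_pos N hN
  have hN0 : (0:ℝ) < N := by exact_mod_cast (by omega : 0 < N)
  have hN2 : (2:ℝ) ≤ N := by exact_mod_cast hN
  have hN1 : (0:ℝ) < N - 1 := by linarith
  set L := Real.log (R / ε) with hLdef
  set ω := sphereVol N with hωdef
  set S := ω * (1 + L) with hS
  have hS0 : 0 < S := by positivity
  set c := S ^ (-(1 / (N:ℝ))) with hc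
  have hc0 : 0 < c := by positivity
  have hcN : c ^ N = S⁻¹ := by
    rw [hc, ← Real.rpow_mul_natCast hS0.le, neg_mul, one_div_mul_cancel hN0.ne', Real.rpow_neg_one]
  refine ⟨moserFun N x0 R ε c, ⟨moserFun_contDiff N x0 R ε c hε, ?_, ?_⟩, ?_, ?_⟩
  · exact HasCompactSupport.of_support_subset_isCompact (isCompact_closedBall x0 R)
      ((subset_tsupport _).trans (moserFun_tsupport N x0 R ε c hR hε))
  · exact (moserFun_tsupport N x0 R ε c hR hε).trans hB
  · apply moser_energy N hN x0 R ε c hε hεR hc0.le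
    rw [hcN, ← hωdef, ← hLdef, hS]
    have : 0 < 1 + L := by linarith
    apply le_of_eq
    field_simp
  · intro x hx
    rw [mem_ball_iff_norm] at hx
    have hval : c * (L - 2) ≤ |moserFun N x0 R ε c x| := by
      refine le_trans ?_ (le_abs_self _)
      unfold moserFun
      gcongr
      refine le_trans ?_ (hfun_ge _)
      have h1 : Real.log (‖x - x0‖ ^ 2 + ε ^ 2) ≤ Real.log 2 + 2 * Real.log ε := by
        rw [show 2 * Real.log ε = Real.log (ε ^ 2) by rw [Real.log_pow]; norm_num,
          ← Real.log_mul (by norm_num) (by positivity)]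
        apply Real.log_le_log (by positivity)
        nlinarith [norm_nonneg (x - x0)]
      have h3 : Real.log 2 ≤ 1 := by have := Real.log_two_lt_d9; linarith
      rw [hLdef, Real.log_div hR.ne' hε.ne']
      linarith
    set p : ℝ := (N : ℝ) / ((N : ℝ) - 1) with hp
    have hp0 : 0 < p := div_pos hN0 hN1
    have hpow : (c * (L - 2)) ^ p ≤ |moserFun N x0 R ε c x| ^ p :=
      Real.rpow_le_rpow (mul_nonneg hc0.le (by linarith)) hval hp0.le
    have hα := alphaMT_pos N hN
    refine le_trans ?_ (mul_le_mul_of_nonneg_left hpow hα.le)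
    set k : ℝ := 1 / ((N:ℝ) - 1) with hk
    have hk0 : 0 < k := by positivity
    have hk1 : k ≤ 1 := by rw [hk, div_le_one hN1]; linarith
    have hpk : p = 1 + k := by rw [hp, hk]; field_simp; ring
    have hcp : c ^ p = (ω ^ k)⁻¹ * ((1 + L) ^ k)⁻¹ := by
      rw [hc, ← Real.rpow_mul hS0.le]
      have : -(1 / (N:ℝ)) * p = -k := by rw [hp, hk]; field_simp
      rw [this, Real.rpow_neg hS0.le, hS, Real.mul_rpow hω.le (by linarith), mul_inv]
    rw [Real.mul_rpow hc0.le (by linarith), hcp, alphaMT, ← hωdef, ← hk, hpk,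
      Real.rpow_add_of_nonneg (by linarith) (by norm_num) hk0.le, Real.rpow_one]
    have hωk : 0 < ω ^ k := by positivity
    have hLk : 0 < (1 + L) ^ k := by positivity
    have e : N * ω ^ k * ((ω ^ k)⁻¹ * ((1 + L) ^ k)⁻¹ * ((L - 2) * (L - 2) ^ k)) =
        N * ((L - 2) * ((L - 2) / (1 + L)) ^ k) := by
      rw [Real.div_rpow (by linarith) (by linarith)]
      field_simp
    rw [e]
    gcongr
    have h1L : 0 < 1 + L := by linarith
    have hq0 : 0 ≤ (L - 2) / (1 + L) := div_nonneg (by linarith) h1L.le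
    have hq1 : (L - 2) / (1 + L) ≤ 1 := by rw [div_le_one h1L]; linarith
    have hq : (L - 2) / (1 + L) ≤ ((L - 2) / (1 + L)) ^ k := by
      rcases hq0.eq_or_lt with h | h
      · rw [← h]; positivity
      · have := Real.rpow_le_rpow_of_exponent_ge h hq1 hk1
        rwa [Real.rpow_one] at this
    calc L - 5 ≤ (L - 2) * ((L - 2) / (1 + L)) := by
          rw [← mul_div_assoc, le_div_iff₀ h1L]; nlinarith
      _ ≤ _ := mul_le_mul_of_nonneg_left hq (by linarith)

lemma sum_le_half_exp (n : ℕ) : ∃ X0 : ℝ, ∀ X : ℝ, X0 ≤ X →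
    ∑ j ∈ Finset.range n, X ^ j / (Nat.factorial j : ℝ) ≤ Real.exp X / 2 := by
  have h : (fun X : ℝ => ∑ j ∈ Finset.range n, X ^ j / (Nat.factorial j : ℝ))
      =o[Filter.atTop] fun X => Real.exp X := by
    apply Asymptotics.IsLittleO.fun_sum
    intro j _
    simp only [div_eq_inv_mul]
    exact (isLittleO_pow_exp_atTop (n := j)).const_mul_left _
  have h2 := h.def (c := 1 / 2) (by norm_num)
  obtain ⟨X0, hX0⟩ := Filter.eventually_atTop.1 h2
  refine ⟨X0, fun X hX => ?_⟩
  have h3 := hX0 X hX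
  rw [Real.norm_of_nonneg (Real.exp_pos X).le] at h3
  have := Real.le_norm_self (∑ j ∈ Finset.range n, X ^ j / (Nat.factorial j : ℝ))
  linarith

lemma PhiGamma_cont (N : ℕ) (hN : 2 ≤ N) (γ : ℝ) : Continuous (PhiGamma N γ) := by
  have hN2 : (2:ℝ) ≤ N := by exact_mod_cast hN
  have hp : 0 ≤ (N : ℝ) / ((N : ℝ) - 1) := div_nonneg (by linarith) (by linarith)
  have hX : Continuous fun t : ℝ => |t| ^ ((N : ℝ) / ((N : ℝ) - 1)) :=
    continuous_abs.rpow_const fun _ => Or.inr hp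
  have : PhiGamma N γ = fun t => Real.exp (γ * |t| ^ ((N : ℝ) / ((N : ℝ) - 1))) -
      ∑ j ∈ Finset.range (N - 1),
        (γ * |t| ^ ((N : ℝ) / ((N : ℝ) - 1))) ^ j / (Nat.factorial j : ℝ) := by
    funext t; exact PhiGamma_eq N hN γ t
  rw [this]
  fun_prop

lemma PhiGamma_zero (N : ℕ) (hN : 2 ≤ N) (γ : ℝ) : PhiGamma N γ 0 = 0 := by
  have hN2 : (2:ℝ) ≤ N := by exact_mod_cast hN
  have hp : 0 < (N : ℝ) / ((N : ℝ) - 1) := div_pos (by linarith) (by linarith)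
  rw [PhiGamma_eq N hN, abs_zero, Real.zero_rpow hp.ne', mul_zero, Real.exp_zero]
  obtain ⟨n, hn⟩ : ∃ n, N - 1 = n + 1 := ⟨N - 2, by omega⟩
  rw [hn, Finset.sum_range_succ']
  simp

lemma test_integrable (N : ℕ) (hN : 2 ≤ N) (i : Fin N) (γ : ℝ)
    (u : EuclideanSpace ℝ (Fin N) → ℝ) (hu : IsTest (unitBall N) u) :
    IntegrableOn (fun x => PhiGamma N γ (u x) * wgt N i x) (unitBall N) := by
  obtain ⟨h1, h2, h3⟩ := hu
  have hK : IntegrableOn (fun x => PhiGamma N γ (u x) * wgt N i x) (tsupport u) := by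
    apply ContinuousOn.integrableOn_compact h2
    exact (((PhiGamma_cont N hN γ).comp h1.continuous).continuousOn).mul ((wgt_cont N i).mono h3)
  have hz : ∀ x, x ∉ tsupport u → PhiGamma N γ (u x) * wgt N i x = 0 := by
    intro x hx
    rw [image_eq_zero_of_notMem_tsupport hx, PhiGamma_zero N hN, zero_mul]
  have : Integrable (fun x => PhiGamma N γ (u x) * wgt N i x) := by
    rw [← integrableOn_iff_integrable_of_support_subset (s := tsupport u)]
    · exact hK
    · intro x hx
      by_contra h
      exact hx (hz x h)
  exact this.integrableOn

lemma wgt_lower (N : ℕ) (hN : 2 ≤ N) (t : ℝ) (ht : 0 < t) (ht4 : t ≤ 1 / 4)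
    (x : EuclideanSpace ℝ (Fin N))
    (hx : x ∈ Metric.ball (EuclideanSpace.single (⟨0, by omega⟩ : Fin N) (1 - t))
      (Real.exp (-(2 / t)))) :
    ((2 * t)⁻¹) ^ (N + 1) / 2 ≤ wgt N ⟨1, by omega⟩ x := by
  set x0 : EuclideanSpace ℝ (Fin N) := EuclideanSpace.single (⟨0, by omega⟩ : Fin N) (1 - t) with hx0
  rw [mem_ball_iff_norm] at hx
  have hs : Real.exp (-(2 / t)) ≤ t / 2 := by
    have := Real.add_one_le_exp (2 / t)
    rw [Real.exp_neg, show t / 2 = (2 / t)⁻¹ by rw [inv_div]]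
    exact inv_anti₀ (by positivity) (by linarith)
  have hn0 : ‖x0‖ = 1 - t := by
    rw [hx0, EuclideanSpace.norm_single, Real.norm_of_nonneg (by linarith)]
  have hd := abs_norm_sub_norm_le x x0
  rw [hn0] at hd
  obtain ⟨hd1, hd2⟩ := abs_le.1 (hd.trans hx.le)
  have d1 : t / 2 ≤ 1 - ‖x‖ := by linarith
  have d2 : 1 - ‖x‖ ≤ 2 * t := by linarith
  have d0 : 0 < 1 - ‖x‖ := by linarith
  have hxi : |x ⟨1, by omega⟩| ≤ Real.exp (-(2 / t)) := by
    have h1 := PiLp.norm_apply_le (x - x0) ⟨1, by omega⟩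
    have h2 : (x - x0) ⟨1, by omega⟩ = x ⟨1, by omega⟩ := by
      simp [hx0]
    rw [h2, Real.norm_eq_abs] at h1
    linarith
  have hprod : |x ⟨1, by omega⟩| * Real.exp ((1 - ‖x‖)⁻¹) ≤ 1 := by
    calc |x ⟨1, by omega⟩| * Real.exp ((1 - ‖x‖)⁻¹)
        ≤ Real.exp (-(2 / t)) * Real.exp (2 / t) := by
          gcongr ?_ * Real.exp ?_
          rw [inv_le_comm₀ d0 (by positivity), inv_div]; exact d1
      _ = 1 := by rw [← Real.exp_add]; simp
  unfold wgt
  have h1 : (2 * t)⁻¹ ≤ (1 - ‖x‖)⁻¹ := inv_anti₀ d0 d2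
  gcongr
  linarith

lemma lower (N : ℕ) (hN : 2 ≤ N) (γ : ℝ) (hγ : 0 < γ) (hγα : alphaMT N ≤ γ) (M : ℝ) :
    ∃ u, IsTest (unitBall N) u ∧ (∫ x in unitBall N, ‖fderiv ℝ u x‖ ^ N) ≤ 1 ∧
      M < ∫ x in unitBall N, PhiGamma N γ (u x) * wgt N ⟨1, by omega⟩ x := by
  obtain ⟨X0, hX0⟩ := sum_le_half_exp (N - 1)
  have hN0 : (0:ℝ) < N := by exact_mod_cast (by omega : 0 < N)
  have hN1 : (1:ℝ) ≤ N := by exact_mod_cast (by omega : 1 ≤ N)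
  set V := (volume : Measure (EuclideanSpace ℝ (Fin N))).real (Metric.ball 0 1) with hV
  have hV0 : 0 < V := ENNReal.toReal_pos (Metric.measure_ball_pos _ _ one_pos).ne'
    measure_ball_lt_top.ne
  set K := V / 4 * Real.exp (-5 * N) * ((4:ℝ)⁻¹) ^ N / 2 with hK
  have hK0 : 0 < K := by positivity
  -- the scale
  obtain ⟨T, hT4, hTX, hTM⟩ : ∃ T : ℝ, 4 ≤ T ∧ |X0| + 5 ≤ T ∧ M < K * T := by
    refine ⟨4 + (|X0| + 5) + |M| / K, ?_, ?_, ?_⟩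
    · have : 0 ≤ |M| / K := by positivity
      linarith [abs_nonneg X0]
    · have : 0 ≤ |M| / K := by positivity
      linarith [abs_nonneg X0]
    · have : K * (|M| / K) = |M| := by field_simp
      have h2 : 0 < K * (4 + (|X0| + 5)) := by positivity
      linarith [le_abs_self M]
  have hT0 : 0 < T := by linarith
  set t := T⁻¹ with ht
  have ht0 : 0 < t := by positivity
  have ht4 : t ≤ 1 / 4 := by
    rw [ht, one_div]; exact inv_anti₀ (by norm_num) hT4
  have hTt : 2 / t = 2 * T := by rw [ht]; field_simp
  set ε := Real.exp (-(2 / t)) with hε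
  have hε0 : 0 < ε := Real.exp_pos _
  have hεR : ε < t / 2 := by
    have := Real.add_one_le_exp (2 / t)
    rw [hε, Real.exp_neg, show t / 2 = (2 / t)⁻¹ by rw [inv_div]]
    exact inv_strictAnti₀ (by positivity) (by linarith)
  set L := Real.log (t / 2 / ε) with hL
  have hLe : Real.exp L = t / 2 / ε := Real.exp_log (by positivity)
  have hLT : T ≤ L := by
    have h1 : L = Real.log (t / 2) + 2 * T := by
      rw [hL, Real.log_div (by positivity) hε0.ne', hε, Real.log_exp, hTt]; ring
    have h2 : Real.log (t / 2) = -(Real.log T + Real.log 2) := by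
      rw [← Real.log_mul hT0.ne' (by norm_num), ← Real.log_inv, ht]
      congr 1; field_simp
    have h3 := Real.log_le_sub_one_of_pos hT0
    have h4 : Real.log 2 ≤ 1 := by have := Real.log_two_lt_d9; linarith
    linarith
  set x0 : EuclideanSpace ℝ (Fin N) := EuclideanSpace.single (⟨0, by omega⟩ : Fin N) (1 - t) with hx0
  have hn0 : ‖x0‖ = 1 - t := by
    rw [hx0, EuclideanSpace.norm_single, Real.norm_of_nonneg (by linarith)]
  have hB : Metric.closedBall x0 (t / 2) ⊆ unitBall N := by
    intro x hx
    rw [mem_closedBall_iff_norm] at hx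
    rw [unitBall, mem_ball_zero_iff]
    have := norm_le_norm_add_norm_sub' x x0
    linarith
  obtain ⟨u, hu, hE, hlow⟩ := moser_exists N hN x0 (t / 2) ε hε0 hεR hB (by linarith)
  refine ⟨u, hu, hE, ?_⟩
  have hsub : Metric.ball x0 ε ⊆ unitBall N :=
    (Metric.ball_subset_closedBall.trans (Metric.closedBall_subset_closedBall hεR.le)).trans hB
  have hint := test_integrable N hN ⟨1, by omega⟩ γ u hu
  set A := Real.exp (N * (L - 5)) / 2 * (((2 * t)⁻¹) ^ (N + 1) / 2) with hA
  have hpt : ∀ x ∈ Metric.ball x0 ε, A ≤ PhiGamma N γ (u x) * wgt N ⟨1, by omega⟩ x := by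
    intro x hx
    have h1 := wgt_lower N hN t ht0 ht4 x hx
    have h2 : Real.exp (N * (L - 5)) / 2 ≤ PhiGamma N γ (u x) := by
      rw [PhiGamma_eq N hN]
      set Y := γ * |u x| ^ ((N : ℝ) / ((N : ℝ) - 1)) with hY
      have hYL : N * (L - 5) ≤ Y := (hlow x hx).trans (by rw [hY]; gcongr)
      have hLX : L - 5 ≤ N * (L - 5) := by
        have : 0 ≤ L - 5 := by linarith [abs_nonneg X0]
        nlinarith
      have h3 := hX0 Y (by linarith [le_abs_self X0])
      have h4 := Real.exp_le_exp.2 hYL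
      linarith
    rw [hA]
    exact mul_le_mul h2 h1 (by positivity) (PhiGamma_nonneg N hN γ _ hγ)
  have hvol : (volume : Measure (EuclideanSpace ℝ (Fin N))).real (Metric.ball x0 ε) = ε ^ N * V := by
    have : Nonempty (Fin N) := ⟨⟨0, by omega⟩⟩
    rw [Measure.real, Measure.addHaar_ball _ _ hε0.le, ENNReal.toReal_mul,
      ENNReal.toReal_ofReal (by positivity), finrank_euclideanSpace_fin, hV, Measure.real]
  have hAK : A * (ε ^ N * V) = K * T := by
    have e1 : Real.exp (N * (L - 5)) = Real.exp (-5 * N) * (t / 2 / ε) ^ N := by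
      rw [← hLe, ← Real.exp_nat_mul, ← Real.exp_add]; congr 1; ring
    have e2 : (t / 2 / ε) ^ N * ((2 * t)⁻¹) ^ N * ε ^ N = ((4:ℝ)⁻¹) ^ N := by
      rw [← mul_pow, ← mul_pow]; congr 1; field_simp; norm_num
    have e3 : (2 * t)⁻¹ = T / 2 := by rw [ht]; field_simp
    calc A * (ε ^ N * V) = V / 4 * Real.exp (-5 * N) *
          ((t / 2 / ε) ^ N * ((2 * t)⁻¹) ^ N * ε ^ N) * (2 * t)⁻¹ := by
          rw [hA, e1, pow_succ]; ring
      _ = K * T := by rw [e2, e3, hK]; ring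
  calc M < K * T := hTM
    _ = A * (ε ^ N * V) := hAK.symm
    _ = ∫ x in Metric.ball x0 ε, A := by
        rw [setIntegral_const, hvol, smul_eq_mul, mul_comm]
    _ ≤ ∫ x in Metric.ball x0 ε, PhiGamma N γ (u x) * wgt N ⟨1, by omega⟩ x := by
        apply setIntegral_mono_on (integrableOn_const measure_ball_lt_top.ne)
          (hint.mono_set hsub) measurableSet_ball hpt
    _ ≤ _ := by
        apply setIntegral_mono_set hint _ hsub.eventuallyLE
        filter_upwards [ae_restrict_mem (show MeasurableSet (unitBall N) from measurableSet_ball)] with x hx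
        exact mul_nonneg (PhiGamma_nonneg N hN γ _ hγ) (wgt_pos N _ x hx).le

/-- For `N ≥ 2` there is a conformal metric `g_ρ = ρ g_e` on the unit ball such that, for
`γ > 0`, the supremum of `∫_B Φ^γ(u) dV_{g_ρ}` over test functions with Dirichlet energy at
most `1` is finite if and only if `0 < γ < α_N`: the supremum is infinite at the critical
exponent but finite at every subcritical one. -/
theorem exists_metric_exponential_summability_below_critical (N : ℕ) (hN : 2 ≤ N) :
    ∃ ρ : EuclideanSpace ℝ (Fin N) → ℝ, ContinuousOn ρ (unitBall N) ∧
      (∀ x ∈ unitBall N, 0 < ρ x) ∧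
      ∀ γ : ℝ, 0 < γ →
        (BddAbove {s : ℝ | ∃ u : EuclideanSpace ℝ (Fin N) → ℝ, IsTest (unitBall N) u ∧
            (∫ x in unitBall N, ‖fderiv ℝ u x‖ ^ N) ≤ 1 ∧
            s = ∫ x in unitBall N, PhiGamma N γ (u x) * ρ x ^ ((N : ℝ) / 2)} ↔
          (0 < γ ∧ γ < alphaMT N)) := by
  have hN0 : (0:ℝ) < N := by exact_mod_cast (by omega : 0 < N)
  set i : Fin N := ⟨1, by omega⟩ with hi
  refine ⟨fun x => wgt N i x ^ (2 / (N : ℝ)), ?_, ?_, ?_⟩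
  · exact (wgt_cont N i).rpow_const fun x hx => Or.inl (wgt_pos N i x hx).ne'
  · intro x hx
    exact Real.rpow_pos_of_pos (wgt_pos N i x hx) _
  · intro γ hγ
    have hcong : ∀ u : EuclideanSpace ℝ (Fin N) → ℝ,
        ∫ x in unitBall N, PhiGamma N γ (u x) * (wgt N i x ^ (2 / (N : ℝ))) ^ ((N : ℝ) / 2) =
          ∫ x in unitBall N, PhiGamma N γ (u x) * wgt N i x := by
      intro u
      apply setIntegral_congr_fun (show MeasurableSet (unitBall N) from measurableSet_ball)
      intro x hx
      simp only
      rw [← Real.rpow_mul (wgt_pos N i x hx).le,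
        show 2 / (N : ℝ) * ((N : ℝ) / 2) = 1 by field_simp, Real.rpow_one]
    constructor
    · intro hb
      refine ⟨hγ, ?_⟩
      by_contra hcon
      obtain ⟨M, hM⟩ := hb
      obtain ⟨u, hu, hE, hlt⟩ := lower N hN γ hγ (not_lt.1 hcon) M
      have := hM ⟨u, hu, hE, rfl⟩
      rw [hcong u] at this
      exact absurd this (not_le.2 hlt)
    · rintro ⟨_, hlt⟩
      obtain ⟨M, hM⟩ := upper N hN i γ hγ hlt
      refine ⟨M, ?_⟩
      rintro s ⟨u, hu, hE, rfl⟩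
      rw [hcong u]
      exact hM u hu hE
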